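/- Let k ≥ 2 be an integer and let p ≥ 4 be real. Then for every ε > 0 there exists a constant C_ε > 0, depending only on k, p and ε, such that for every positive integer N and every sequence of complex numbers (a_n)_{n=-N}^{N}, one has ‖∑_{n=-N}^{N} a_n e(n x − n² x^k)‖_{L^p(-1,1)} ≤ C_ε N^{1/2 − 1/p + ε} (∑_{n=-N}^{N} |a_n|²)^{1/2}. -/

import Mathlib

open MeasureTheory

/-- `e z = e^{2πiz}`. -/
noncomputable def e (t : ℝ) : ℂ := Complex.exp (2 * Real.pi * Complex.I * t)

theorem e_add (s t : ℝ) : e (s + t) = e s * e t := by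
  simp only [e, ← Complex.exp_add]
  push_cast
  ring_nf

theorem e_eq_exp_ofReal_mul_I (t : ℝ) : e t = Complex.exp (((2 * Real.pi * t : ℝ) : ℂ) * Complex.I) := by
  rw [e]
  push_cast
  ring_nf

theorem norm_e (t : ℝ) : ‖e t‖ = 1 := by
  rw [e_eq_exp_ofReal_mul_I, Complex.norm_exp_ofReal_mul_I]

theorem conj_e (t : ℝ) : (starRingEnd ℂ) (e t) = e (-t) := by
  rw [e_eq_exp_ofReal_mul_I, e_eq_exp_ofReal_mul_I, ← Complex.exp_conj, map_mul, Complex.conj_ofReal,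
    Complex.conj_I]
  push_cast
  ring_nf

theorem continuous_e : Continuous e := by
  unfold e
  fun_prop

theorem four_mul_norm_le_norm_one_sub_e (t : ℝ) : 4 * ‖(t : UnitAddCircle)‖ ≤ ‖1 - e t‖ := by
  have h1 : ‖1 - e t‖ = 2 * |Real.sin (Real.pi * t)| := by
    rw [norm_sub_rev, e_eq_exp_ofReal_mul_I, mul_comm _ Complex.I,
      Complex.norm_exp_I_mul_ofReal_sub_one, Real.norm_eq_abs, abs_mul, abs_two]
    ring_nf
  have h2 : |Real.sin (Real.pi * t)| = |Real.sin (Real.pi * (t - round t))| := by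
    rw [mul_sub, mul_comm Real.pi (round t : ℝ), Real.sin_sub_int_mul_pi, abs_mul]
    simp [abs_zpow]
  have h3 := Real.mul_abs_le_abs_sin (x := Real.pi * (t - round t)) (by
    rw [abs_mul, abs_of_pos Real.pi_pos]
    have := abs_sub_round t
    nlinarith [Real.pi_pos])
  rw [abs_mul, abs_of_pos Real.pi_pos] at h3
  have h4 : 2 / Real.pi * (Real.pi * |t - round t|) = 2 * |t - round t| := by
    field_simp
  rw [UnitAddCircle.norm_eq, h1, h2]
  linarith

theorem sum_Icc_sub_succ (f : ℤ → ℂ) (a b : ℤ) (hab : a ≤ b + 1) :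
    ∑ n ∈ Finset.Icc a b, (f n - f (n + 1)) = f a - f (b + 1) := by
  obtain ⟨L, hL⟩ : ∃ L : ℕ, b + 1 = a + L := ⟨(b + 1 - a).toNat, by omega⟩
  induction L generalizing b with
  | zero =>
    have : Finset.Icc a b = ∅ := Finset.Icc_eq_empty (by push_cast at hL; omega)
    rw [this, hL]
    simp
  | succ L ih =>
    have h := ih (b - 1) (by push_cast at hL; omega) (by push_cast at hL; omega)
    have : Finset.Icc a b = insert b (Finset.Icc a (b - 1)) := by
      ext n
      simp only [Finset.mem_insert, Finset.mem_Icc]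
      push_cast at hL
      omega
    rw [this, Finset.sum_insert (by simp), h]
    simp

/-- The indicator of the event that `t` lies within `δ` of an integer. -/
noncomputable def nearInt (δ t : ℝ) : ℝ := if ‖(t : UnitAddCircle)‖ ≤ δ then 1 else 0

theorem nearInt_nonneg (δ t : ℝ) : 0 ≤ nearInt δ t := by
  unfold nearInt
  split_ifs <;> norm_num

theorem nearInt_le_one (δ t : ℝ) : nearInt δ t ≤ 1 := by
  unfold nearInt
  split_ifs <;> norm_num

theorem nearInt_neg (δ t : ℝ) : nearInt δ (-t) = nearInt δ t := by
  simp [nearInt]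

theorem measurable_nearInt_comp (δ : ℝ) {g : ℝ → ℝ} (hg : Continuous g) :
    Measurable fun y => nearInt δ (g y) := by
  unfold nearInt
  refine Measurable.ite (IsClosed.measurableSet ?_) measurable_const measurable_const
  exact isClosed_le (continuous_norm.comp ((AddCircle.continuous_mk' 1).comp hg)) continuous_const

theorem intervalIntegrable_nearInt_comp (δ : ℝ) {g : ℝ → ℝ} (hg : Continuous g) (a b : ℝ) :
    IntervalIntegrable (fun y => nearInt δ (g y)) volume a b := by
  refine (intervalIntegrable_const (c := (1 : ℝ))).mono_fun
    (measurable_nearInt_comp δ hg).aestronglyMeasurable (Filter.Eventually.of_forall fun y => ?_)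
  simp only [norm_one, Real.norm_of_nonneg (nearInt_nonneg _ _)]
  exact nearInt_le_one _ _

/-- A geometric sum with at most `M` terms is controlled by counting the `m ≤ M` for which the
common ratio's frequency is within `1 / m` of an integer. -/
theorem norm_sum_e_le (θ : ℝ) (v a b : ℤ) (M : ℕ) (hM : b + 1 - a ≤ M) :
    ‖∑ n ∈ Finset.Icc a b, e ((2 * n - v) * θ)‖ ≤
      1 + ∑ m ∈ Finset.Icc 1 M, nearInt (1 / m) (2 * θ) := by
  set d := ‖((2 * θ : ℝ) : UnitAddCircle)‖ with hd
  have hnn : 0 ≤ ∑ m ∈ Finset.Icc 1 M, nearInt (1 / m) (2 * θ) :=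
    Finset.sum_nonneg fun _ _ => nearInt_nonneg _ _
  rcases lt_or_ge (b + 1) a with hlt | hab
  · rw [Finset.Icc_eq_empty (by omega)]
    simp only [Finset.sum_empty, norm_zero]
    linarith
  have hgeom : d * ‖∑ n ∈ Finset.Icc a b, e ((2 * n - v) * θ)‖ ≤ 1 / 2 := by
    have h1 : (1 - e (2 * θ)) * ∑ n ∈ Finset.Icc a b, e ((2 * n - v) * θ) =
        e ((2 * a - v) * θ) - e ((2 * (b + 1 : ℤ) - v) * θ) := by
      rw [← sum_Icc_sub_succ (fun n => e ((2 * n - v) * θ)) a b hab, Finset.mul_sum]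
      refine Finset.sum_congr rfl fun n _ => ?_
      rw [sub_mul, one_mul, ← e_add]
      congr 2
      push_cast
      ring
    have h2 : ‖1 - e (2 * θ)‖ * ‖∑ n ∈ Finset.Icc a b, e ((2 * n - v) * θ)‖ ≤ 2 := by
      rw [← norm_mul, h1]
      refine (norm_sub_le _ _).trans ?_
      rw [norm_e, norm_e]
      norm_num
    have h3 := four_mul_norm_le_norm_one_sub_e (2 * θ)
    nlinarith [norm_nonneg (∑ n ∈ Finset.Icc a b, e ((2 * n - v) * θ))]
  by_cases hsmall : d * M ≤ 1
  · have h1 : ∑ m ∈ Finset.Icc 1 M, nearInt (1 / m) (2 * θ) = M := by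
      rw [Finset.sum_congr rfl (g := fun _ => (1 : ℝ))]
      · simp
      · intro m hm
        rw [Finset.mem_Icc] at hm
        have hm0 : (0 : ℝ) < m := by exact_mod_cast hm.1
        have hmM : (m : ℝ) ≤ M := by exact_mod_cast hm.2
        rw [nearInt, if_pos]
        rw [le_div_iff₀ hm0]
        exact (mul_le_mul_of_nonneg_left hmM (norm_nonneg _)).trans hsmall
    have h2 : ‖∑ n ∈ Finset.Icc a b, e ((2 * n - v) * θ)‖ ≤ M := by
      refine (norm_sum_le _ _).trans ?_
      simp only [norm_e, Finset.sum_const, Int.card_Icc, nsmul_eq_mul, mul_one]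
      exact_mod_cast (show (b + 1 - a).toNat ≤ M by omega)
    linarith
  · push Not at hsmall
    have hd0 : 0 < d := by
      by_contra h
      have : d = 0 := le_antisymm (not_lt.mp h) (norm_nonneg _)
      rw [this] at hsmall
      norm_num at hsmall
    set m₀ := ⌊1 / d⌋₊ with hm₀
    have hm₀M : m₀ ≤ M := by
      refine Nat.floor_le_of_le ?_
      rw [div_le_iff₀ hd0]
      linarith
    have h1 : (m₀ : ℝ) ≤ ∑ m ∈ Finset.Icc 1 M, nearInt (1 / m) (2 * θ) := by
      calc (m₀ : ℝ) = ∑ m ∈ Finset.Icc 1 m₀, (1 : ℝ) := by simp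
        _ = ∑ m ∈ Finset.Icc 1 m₀, nearInt (1 / m) (2 * θ) := by
          refine Finset.sum_congr rfl fun m hm => ?_
          rw [Finset.mem_Icc] at hm
          have hm0 : (0 : ℝ) < m := by exact_mod_cast hm.1
          rw [nearInt, if_pos]
          have h2 : (m : ℝ) ≤ 1 / d := (Nat.le_floor_iff (by positivity)).mp hm.2
          rw [le_div_iff₀ hd0] at h2
          rw [le_div_iff₀ hm0]
          linarith
        _ ≤ _ := Finset.sum_le_sum_of_subset_of_nonneg (Finset.Icc_subset_Icc_right hm₀M)
          fun _ _ _ => nearInt_nonneg _ _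
    have h2 : 1 / d < m₀ + 1 := Nat.lt_floor_add_one _
    have h3 : ‖∑ n ∈ Finset.Icc a b, e ((2 * n - v) * θ)‖ ≤ 1 / d := by
      rw [le_div_iff₀ hd0]
      linarith
    linarith

theorem sum_Icc_sum_Icc_eq (F : ℤ → ℤ → ℂ) (N : ℕ) :
    ∑ n ∈ Finset.Icc (-(N : ℤ)) N, ∑ m ∈ Finset.Icc (-(N : ℤ)) N, F n m =
      ∑ v ∈ Finset.Icc (-(2 * N : ℤ)) (2 * N),
        ∑ n ∈ Finset.Icc (max (-(N : ℤ)) (v - N)) (min (N : ℤ) (v + N)), F n (v - n) := by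
  simp_rw [Finset.sum_sigma']
  refine Finset.sum_nbij' (fun x => ⟨x.1 + x.2, x.1⟩) (fun x => ⟨x.2, x.1 - x.2⟩) ?_ ?_ ?_ ?_ ?_
  · rintro ⟨n, m⟩ h
    simp only [Finset.mem_sigma, Finset.mem_Icc] at h ⊢
    omega
  · rintro ⟨v, n⟩ h
    simp only [Finset.mem_sigma, Finset.mem_Icc] at h ⊢
    omega
  · rintro ⟨n, m⟩ h
    simp
  · rintro ⟨v, n⟩ h
    simp
  · rintro ⟨n, m⟩ h
    simp

theorem norm_sq_weylSum_le (N : ℕ) (β t : ℝ) :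
    ‖∑ n ∈ Finset.Icc (-(N : ℤ)) N, e (n * β - n ^ 2 * t)‖ ^ 2 ≤
      ∑ v ∈ Finset.Icc (-(2 * N : ℤ)) (2 * N),
        (1 + ∑ m ∈ Finset.Icc 1 (2 * N + 1), nearInt (1 / m) (2 * (β - v * t))) := by
  have h : ((‖∑ n ∈ Finset.Icc (-(N : ℤ)) N, e (n * β - n ^ 2 * t)‖ ^ 2 : ℝ) : ℂ) =
      ∑ v ∈ Finset.Icc (-(2 * N : ℤ)) (2 * N),
        ∑ n ∈ Finset.Icc (max (-(N : ℤ)) (v - N)) (min (N : ℤ) (v + N)),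
          e ((2 * n - v) * (β - v * t)) := by
    push_cast
    rw [← Complex.mul_conj', map_sum, Finset.sum_mul_sum, sum_Icc_sum_Icc_eq]
    refine Finset.sum_congr rfl fun v _ => Finset.sum_congr rfl fun n _ => ?_
    rw [conj_e, ← e_add]
    congr 1
    push_cast
    ring
  have h2 := congrArg norm h
  rw [Complex.norm_real, Real.norm_of_nonneg (by positivity)] at h2
  rw [h2]
  refine (norm_sum_le _ _).trans (Finset.sum_le_sum fun v _ => norm_sum_e_le _ _ _ _ _ ?_)
  push_cast
  omega

theorem sum_nearInt_le (N : ℕ) (δ β t : ℝ) :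
    ∑ v ∈ Finset.Icc (-(2 * N : ℤ)) (2 * N), nearInt δ (2 * (β - v * t)) ≤
      1 + ∑ w ∈ Finset.Icc 1 (4 * N), nearInt (2 * δ) (2 * w * t) := by
  classical
  set S := (Finset.Icc (-(2 * N : ℤ)) (2 * N)).filter
    fun v : ℤ => ‖((2 * (β - v * t) : ℝ) : UnitAddCircle)‖ ≤ δ with hS
  set T := (Finset.Icc 1 (4 * N)).filter
    fun w : ℕ => ‖((2 * w * t : ℝ) : UnitAddCircle)‖ ≤ 2 * δ with hT
  have h1 : ∑ v ∈ Finset.Icc (-(2 * N : ℤ)) (2 * N), nearInt δ (2 * (β - v * t)) = S.card := by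
    simp [nearInt, hS, Finset.sum_boole]
  have h2 : ∑ w ∈ Finset.Icc 1 (4 * N), nearInt (2 * δ) (2 * w * t) = T.card := by
    simp [nearInt, hT, Finset.sum_boole]
  rw [h1, h2]
  rcases S.eq_empty_or_nonempty with h0 | hne
  · rw [h0]
    simp
    positivity
  set v₀ := S.min' hne
  have hv₀ : v₀ ∈ S := S.min'_mem hne
  have hcard : (S.erase v₀).card ≤ T.card := by
    refine Finset.card_le_card_of_injOn (fun v => (v - v₀).toNat) ?_ ?_
    · intro v hv
      rw [Finset.mem_coe, Finset.mem_erase] at hv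
      have hlt : v₀ < v := lt_of_le_of_ne (S.min'_le v hv.2) (Ne.symm hv.1)
      have hv2 := hv.2
      simp only [hS, Finset.mem_filter, Finset.mem_Icc] at hv₀ hv2
      simp only [hT, Finset.coe_filter, Finset.mem_Icc, Set.mem_ofPred_eq]
      refine ⟨by omega, ?_⟩
      have hc : (((v - v₀).toNat : ℕ) : ℝ) = (v : ℝ) - v₀ := by
        have : (((v - v₀).toNat : ℕ) : ℤ) = v - v₀ := Int.toNat_of_nonneg (by omega)
        exact_mod_cast this
      rw [hc]
      have : ((2 * ((v : ℝ) - v₀) * t : ℝ) : UnitAddCircle) =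
          ((2 * (β - v₀ * t) : ℝ) : UnitAddCircle) - ((2 * (β - v * t) : ℝ) : UnitAddCircle) := by
        rw [← AddCircle.coe_sub]
        congr 1
        ring
      rw [this]
      refine (norm_sub_le _ _).trans ?_
      linarith [hv₀.2, hv2.2]
    · intro v hv v' hv' hvv
      rw [Finset.mem_coe, Finset.mem_erase] at hv hv'
      have h1 := S.min'_le v hv.2
      have h2 := S.min'_le v' hv'.2
      simp only at hvv
      omega
  rw [Finset.card_erase_of_mem hv₀] at hcard
  have : S.card ≤ 1 + T.card := by omega
  exact_mod_cast this

/-- A function growing at rate at least `μ` on `[a, b]` spends time at most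
`(g b - g a + 6) * (2 * δ / μ)` within `δ` of the integers. -/
theorem integral_nearInt_le {g : ℝ → ℝ} (hg : Continuous g) {a b μ δ : ℝ} (hab : a ≤ b)
    (hμ : 0 < μ) (hδ : 0 ≤ δ) (hδ2 : δ ≤ 2)
    (hslope : ∀ x y, a ≤ x → x ≤ y → y ≤ b → μ * (y - x) ≤ g y - g x) :
    ∫ y in a..b, nearInt δ (g y) ≤ (g b - g a + 6) * (2 * δ / μ) := by
  set J := Finset.Icc ⌈g a - δ⌉ ⌊g b + δ⌋ with hJ
  set S : ℤ → Set ℝ := fun j => Set.Ioc a b ∩ {y | |g y - j| ≤ δ} with hS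
  have hSmeas : ∀ j, MeasurableSet (S j) := fun j =>
    measurableSet_Ioc.inter (isClosed_le (by fun_prop) continuous_const).measurableSet
  have hmono : ∀ x y, a ≤ x → x ≤ y → y ≤ b → g x ≤ g y := fun x y h1 h2 h3 => by
    have := hslope x y h1 h2 h3
    nlinarith [mul_nonneg hμ.le (sub_nonneg.mpr h2)]
  have hSvol : ∀ j, volume.real (S j) ≤ 2 * δ / μ := by
    intro j
    have h1 : volume (S j) ≤ ENNReal.ofReal (2 * δ / μ) := by
      refine (Real.volume_le_diam _).trans (Metric.ediam_le_of_forall_dist_le ?_)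
      have key : ∀ x ∈ S j, ∀ y ∈ S j, x ≤ y → dist x y ≤ 2 * δ / μ := by
        intro x hx y hy hxy
        have h2 := hslope x y hx.1.1.le hxy hy.1.2
        have h3 := abs_le.mp (show |g x - j| ≤ δ from hx.2)
        have h4 := abs_le.mp (show |g y - j| ≤ δ from hy.2)
        rw [Real.dist_eq, abs_sub_comm, abs_of_nonneg (by linarith), le_div_iff₀ hμ]
        linarith
      intro x hx y hy
      rcases le_total x y with h | h
      · exact key x hx y hy h
      · rw [dist_comm]
        exact key y hy x hx h
    exact ENNReal.toReal_le_of_le_ofReal (by positivity) h1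
  have hSfin : ∀ j, volume (S j) ≠ ⊤ := fun j =>
    ((measure_mono Set.inter_subset_left).trans_lt measure_Ioc_lt_top).ne
  have hJcard : (J.card : ℝ) ≤ g b - g a + 6 := by
    have h0 := hmono a b le_rfl hab le_rfl
    rw [hJ, Int.card_Icc]
    have h1 := Int.floor_le (g b + δ)
    have h2 := Int.le_ceil (g a - δ)
    have h3 : (((⌊g b + δ⌋ + 1 - ⌈g a - δ⌉).toNat : ℤ) : ℝ) =
        ((max (⌊g b + δ⌋ + 1 - ⌈g a - δ⌉) 0 : ℤ) : ℝ) := by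
      rw [Int.toNat_eq_max]
    rw [← Int.cast_natCast, h3]
    push_cast
    refine max_le ?_ ?_ <;> linarith
  have hpt : ∀ y ∈ Set.Ioc a b, nearInt δ (g y) ≤ ∑ j ∈ J, (S j).indicator 1 y := by
    intro y hy
    have hnn : ∀ j ∈ J, (0 : ℝ) ≤ (S j).indicator 1 y := fun j _ =>
      Set.indicator_nonneg (fun _ _ => zero_le_one) _
    rw [nearInt]
    split_ifs with h
    · rw [UnitAddCircle.norm_eq] at h
      have h1 := abs_le.mp h
      have hmem : round (g y) ∈ J := by
        rw [hJ, Finset.mem_Icc, Int.ceil_le, Int.le_floor]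
        have h2 := hmono a y le_rfl hy.1.le hy.2
        have h3 := hmono y b hy.1.le hy.2 le_rfl
        constructor <;> linarith
      refine le_trans (le_of_eq ?_) (Finset.single_le_sum hnn hmem)
      rw [Set.indicator_of_mem (show y ∈ S (round (g y)) from ⟨hy, h⟩)]
      rfl
    · exact Finset.sum_nonneg hnn
  have hSint : ∀ j ∈ J, IntegrableOn ((S j).indicator (1 : ℝ → ℝ)) (Set.Ioc a b) volume := by
    intro j _
    exact ((integrable_indicator_iff (hSmeas j)).mpr
      (integrableOn_const (hSfin j))).integrableOn
  rw [intervalIntegral.integral_of_le hab]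
  calc ∫ y in Set.Ioc a b, nearInt δ (g y)
      ≤ ∫ y in Set.Ioc a b, ∑ j ∈ J, (S j).indicator 1 y := by
        refine setIntegral_mono_on ?_ (integrable_finsetSum _ hSint) measurableSet_Ioc hpt
        exact (intervalIntegrable_nearInt_comp δ hg a b).1
    _ = ∑ j ∈ J, ∫ y in Set.Ioc a b, (S j).indicator 1 y := integral_finsetSum _ hSint
    _ ≤ ∑ j ∈ J, 2 * δ / μ := by
        refine Finset.sum_le_sum fun j _ => ?_
        rw [integral_indicator_one (hSmeas j), measureReal_restrict_apply (hSmeas j)]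
        exact (measureReal_mono Set.inter_subset_left (hSfin j)).trans (hSvol j)
    _ = J.card * (2 * δ / μ) := by rw [Finset.sum_const, nsmul_eq_mul]
    _ ≤ _ := mul_le_mul_of_nonneg_right hJcard (by positivity)

theorem pow_sub_pow_ge {k : ℕ} (hk : 1 ≤ k) {r x y : ℝ} (hr : 0 ≤ r) (hrx : r ≤ x) (hxy : x ≤ y) :
    r ^ (k - 1) * (y - x) ≤ y ^ k - x ^ k := by
  obtain ⟨l, rfl⟩ : ∃ l, k = l + 1 := ⟨k - 1, by omega⟩
  have h1 : r ^ l ≤ y ^ l := by gcongr; linarith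
  have h2 : x ^ l ≤ y ^ l := by gcongr; linarith
  rw [Nat.add_sub_cancel, pow_succ, pow_succ]
  nlinarith [mul_nonneg (sub_nonneg.mpr h1) (sub_nonneg.mpr hxy),
    mul_nonneg (sub_nonneg.mpr h2) (hr.trans hrx)]

theorem pow_sub_pow_le {k : ℕ} {r x y : ℝ} (hx : 0 ≤ x) (hxy : x ≤ y) (hyr : y ≤ r) :
    y ^ k - x ^ k ≤ k * r ^ (k - 1) * (y - x) := by
  have hr : 0 ≤ r := hx.trans (hxy.trans hyr)
  induction k with
  | zero => simp
  | succ l ih =>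
    have h1 : y ^ l ≤ r ^ l := by gcongr; linarith
    rcases Nat.eq_zero_or_pos l with rfl | hl
    · simp
    have h2 : r ^ l = r ^ (l - 1) * r := by rw [← pow_succ]; congr 1; omega
    have h3 : x * (y ^ l - x ^ l) ≤ l * r ^ l * (y - x) := by
      rw [h2]
      have h4 : 0 ≤ l * r ^ (l - 1) * (y - x) := by
        have := sub_nonneg.mpr hxy
        positivity
      have h5 : x ≤ r := hxy.trans hyr
      calc x * (y ^ l - x ^ l) ≤ x * (l * r ^ (l - 1) * (y - x)) := by gcongr
        _ ≤ r * (l * r ^ (l - 1) * (y - x)) := by gcongr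
        _ = _ := by ring
    have h6 := mul_le_mul_of_nonneg_right h1 (sub_nonneg.mpr hxy)
    rw [Nat.add_sub_cancel, pow_succ, pow_succ]
    push_cast
    nlinarith

/-- Near the origin the phase `y - v * y ^ k` is monotone, whatever `v` is. -/
theorem integral_nearInt_le_of_small {k N : ℕ} {r : ℝ} (hr0 : 0 ≤ r) (hr1 : r ≤ 1)
    (hr : 4 * N * k * r ^ (k - 1) ≤ 1) (c d : ℝ) {v : ℤ}
    (hv : v ∈ Finset.Icc (-(2 * N : ℤ)) (2 * N)) {m : ℕ} (hm : 1 ≤ m) :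
    ∫ y in 0..r, nearInt (1 / m) (2 * ((c - y) - v * (d - y ^ k))) ≤ 20 / m := by
  rw [Finset.mem_Icc] at hv
  have hm' : (1 : ℝ) ≤ m := by exact_mod_cast hm
  have hv' : |(v : ℝ)| ≤ 2 * N := by
    rw [abs_le]
    constructor
    · exact_mod_cast hv.1
    · exact_mod_cast hv.2
  have hosc : ∀ x y, 0 ≤ x → x ≤ y → y ≤ r → |2 * v * (y ^ k - x ^ k)| ≤ y - x := by
    intro x y hx hxy hy
    have h1 := pow_sub_pow_le (k := k) hx hxy hy
    have h2 : 0 ≤ y ^ k - x ^ k := sub_nonneg.mpr (by gcongr)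
    have h3 := sub_nonneg.mpr hxy
    rw [abs_mul, abs_mul, abs_two, abs_of_nonneg h2]
    calc 2 * |(v : ℝ)| * (y ^ k - x ^ k) ≤ 2 * (2 * N) * (k * r ^ (k - 1) * (y - x)) := by gcongr
      _ = (4 * N * k * r ^ (k - 1)) * (y - x) := by ring
      _ ≤ 1 * (y - x) := by gcongr
      _ = _ := one_mul _
  set g : ℝ → ℝ := fun y => -(2 * ((c - y) - v * (d - y ^ k))) with hg
  have hmain := integral_nearInt_le (g := g) (a := 0) (b := r) (μ := 1) (δ := 1 / m)
    (by fun_prop) hr0 one_pos (by positivity)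
    (by rw [div_le_iff₀ (by linarith)]; linarith) (by
      intro x y hx hxy hy
      have := abs_le.mp (hosc x y hx hxy hy)
      simp only [hg]
      linarith)
  have hG : g r - g 0 ≤ 3 := by
    have := abs_le.mp (hosc 0 r le_rfl hr0 le_rfl)
    simp only [hg]
    linarith
  simp only [hg, nearInt_neg] at hmain
  refine hmain.trans ?_
  have : (0 : ℝ) ≤ 2 * (1 / m) / 1 := by positivity
  calc (g r - g 0 + 6) * (2 * (1 / m) / 1) ≤ 10 * (2 * (1 / m) / 1) := by gcongr; linarith
    _ = 20 / m := by ring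

theorem integral_nearInt_pow_le {k : ℕ} (hk : 1 ≤ k) {r : ℝ} (hr0 : 0 < r) (hr1 : 2 * r ≤ 1)
    (d : ℝ) {w m : ℕ} (hw : 1 ≤ w) (hm : 1 ≤ m) :
    ∫ y in r..2 * r, nearInt (2 * (1 / m)) (2 * w * (d - y ^ k)) ≤
      (2 ^ (k + 1) + 12 / (w * r ^ (k - 1))) / m := by
  have hm' : (1 : ℝ) ≤ m := by exact_mod_cast hm
  have hw' : (1 : ℝ) ≤ w := by exact_mod_cast hw
  set g : ℝ → ℝ := fun y => -(2 * w * (d - y ^ k)) with hg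
  have hmain := integral_nearInt_le (g := g) (a := r) (b := 2 * r) (μ := 2 * w * r ^ (k - 1))
    (δ := 2 * (1 / m)) (by fun_prop) (by linarith) (by positivity) (by positivity)
    (by
      have : 1 / (m : ℝ) ≤ 1 := by rw [div_le_iff₀ (by linarith)]; linarith
      linarith) (by
      intro x y hx hxy hy
      have h1 := pow_sub_pow_ge hk hr0.le hx hxy
      simp only [hg]
      have := mul_le_mul_of_nonneg_left h1 (show (0 : ℝ) ≤ 2 * w by positivity)
      linarith)
  have hG : g (2 * r) - g r ≤ 2 * w * 2 ^ k * r ^ (k - 1) * (1 / 2) := by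
    have h1 : r ^ k = r ^ (k - 1) * r := by rw [← pow_succ]; congr 1; omega
    have h2 : 0 ≤ 2 * w * r ^ k := by positivity
    have h3 : (2 * w : ℝ) * 2 ^ k * r ^ (k - 1) * r ≤ 2 * w * 2 ^ k * r ^ (k - 1) * (1 / 2) := by
      gcongr
      linarith
    have h4 : g (2 * r) - g r = 2 * w * 2 ^ k * r ^ (k - 1) * r - 2 * w * r ^ k := by
      simp only [hg, mul_pow]
      rw [h1]
      ring
    linarith
  simp only [hg, nearInt_neg] at hmain
  refine hmain.trans ?_
  calc (g (2 * r) - g r + 6) * (2 * (2 * (1 / m)) / (2 * w * r ^ (k - 1)))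
      ≤ (2 * w * 2 ^ k * r ^ (k - 1) * (1 / 2) + 6) * (2 * (2 * (1 / m)) / (2 * w * r ^ (k - 1))) := by
        gcongr
    _ = _ := by
        field_simp
        ring

theorem sum_Icc_one_div_le {M L : ℕ} (hM : 1 ≤ M) (hML : M ≤ L) :
    ∑ m ∈ Finset.Icc 1 M, 1 / (m : ℝ) ≤ 1 + Real.log L := by
  have h1 := harmonic_le_one_add_log M
  rw [harmonic_eq_sum_Icc] at h1
  push_cast at h1
  have h2 : Real.log M ≤ Real.log L :=
    Real.log_le_log (by exact_mod_cast hM) (by exact_mod_cast hML)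
  simp only [one_div]
  linarith

theorem intervalIntegrable_finsetSum {ι : Type*} (s : Finset ι) {f : ι → ℝ → ℝ} {a b : ℝ}
    (h : ∀ i ∈ s, IntervalIntegrable (f i) volume a b) :
    IntervalIntegrable (fun y => ∑ i ∈ s, f i y) volume a b :=
  ⟨integrable_finsetSum s fun i hi => (h i hi).1, integrable_finsetSum s fun i hi => (h i hi).2⟩

theorem exists_dyadic_radius {k : ℕ} (hk : 2 ≤ k) {N : ℕ} (hN : 0 < N) :
    ∃ J : ℕ, 4 * N * k * ((1 / 2 : ℝ) ^ J) ^ (k - 1) ≤ 1 ∧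
      1 / ((1 / 2 : ℝ) ^ J) ^ (k - 1) ≤ 4 * N * k * 2 ^ k ∧
      (J : ℝ) ≤ (3 + 2 * Real.log k) * (1 + Real.log ((4 * N : ℕ) : ℝ)) := by
  have hex : ∃ J : ℕ, 4 * N * k ≤ (2 ^ J) ^ (k - 1) := by
    refine ⟨4 * N * k, Nat.lt_two_pow_self.le.trans ?_⟩
    exact Nat.le_self_pow (by omega) _
  classical
  set J := Nat.find hex with hJ
  have hJ1 : 4 * N * k ≤ (2 ^ J) ^ (k - 1) := Nat.find_spec hex
  have hJ0 : J ≠ 0 := by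
    intro h
    rw [h] at hJ1
    simp only [pow_zero, one_pow] at hJ1
    have : 1 * 2 ≤ N * k := Nat.mul_le_mul hN hk
    nlinarith
  obtain ⟨I, hI⟩ : ∃ I, J = I + 1 := ⟨J - 1, by omega⟩
  have hI1 : (2 ^ I) ^ (k - 1) < 4 * N * k := by
    have := Nat.find_min hex (m := I) (by omega)
    omega
  have e1 : ((1 / 2 : ℝ) ^ J) ^ (k - 1) = 1 / (((2 ^ J) ^ (k - 1) : ℕ) : ℝ) := by
    push_cast
    rw [one_div_pow, one_div_pow]
  have hpos : (0 : ℝ) < (((2 ^ J) ^ (k - 1) : ℕ) : ℝ) := by positivity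
  refine ⟨J, ?_, ?_, ?_⟩
  · rw [e1, mul_one_div, div_le_one hpos]
    exact_mod_cast hJ1
  · rw [e1, one_div_one_div]
    have : (2 ^ J) ^ (k - 1) ≤ 4 * N * k * 2 ^ k := by
      rw [hI, pow_succ, mul_pow]
      exact Nat.mul_le_mul hI1.le (Nat.pow_le_pow_right (by norm_num) (by omega))
    exact_mod_cast this
  · have h1 : (2 : ℝ) ^ I ≤ (4 * N : ℕ) * k := by
      have : 2 ^ I ≤ 4 * N * k := (Nat.le_self_pow (by omega) _).trans hI1.le
      exact_mod_cast this
    have h2 := Real.log_le_log (by positivity) h1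
    have hk0 : (0 : ℝ) < k := by positivity
    have hN0 : (0 : ℝ) < (4 * N : ℕ) := by positivity
    rw [Real.log_pow, Real.log_mul hN0.ne' hk0.ne'] at h2
    have h3 : (0 : ℝ) ≤ Real.log k := Real.log_natCast_nonneg k
    have h4 : (0 : ℝ) ≤ Real.log ((4 * N : ℕ) : ℝ) := Real.log_natCast_nonneg _
    have h5 : (1 / 2 : ℝ) ≤ Real.log 2 := by linarith [Real.log_two_gt_d9]
    have h6 : (I : ℝ) * (1 / 2) ≤ I * Real.log 2 := by gcongr
    rw [hI]
    push_cast at *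
    nlinarith [mul_nonneg h3 h4]

theorem exists_integral_sum_nearInt_le {k : ℕ} (hk : 2 ≤ k) :
    ∃ C > (0 : ℝ), ∀ N : ℕ, 0 < N → ∀ c d : ℝ,
      ∫ y in (0 : ℝ)..1, ∑ v ∈ Finset.Icc (-(2 * N : ℤ)) (2 * N),
        ∑ m ∈ Finset.Icc 1 (2 * N + 1), nearInt (1 / m) (2 * ((c - y) - v * (d - y ^ k))) ≤
      C * (N * (1 + Real.log ((4 * N : ℕ) : ℝ)) ^ 3) := by
  have hlogk : (0 : ℝ) ≤ Real.log k := Real.log_natCast_nonneg k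
  set B : ℝ := 3 + 4 * 2 ^ (k + 1) + 48 * k * 2 ^ k with hB
  refine ⟨100 + (3 + 2 * Real.log k) * B, by positivity, fun N hN c d => ?_⟩
  obtain ⟨J, hJ1, hJ2, hJ3⟩ := exists_dyadic_radius hk hN
  set L := 1 + Real.log ((4 * N : ℕ) : ℝ) with hL
  have hL1 : 1 ≤ L := by
    have := Real.log_natCast_nonneg (4 * N)
    linarith
  have hN1 : (1 : ℝ) ≤ N := by exact_mod_cast hN
  have hH : ∑ m ∈ Finset.Icc 1 (2 * N + 1), 1 / (m : ℝ) ≤ L :=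
    sum_Icc_one_div_le (by omega) (by omega)
  have hH4 : ∑ m ∈ Finset.Icc 1 (4 * N), 1 / (m : ℝ) ≤ L :=
    sum_Icc_one_div_le (by omega) le_rfl
  set r₀ : ℝ := (1 / 2) ^ J with hr₀
  have hr₀0 : 0 < r₀ := by positivity
  have hr₀1 : r₀ ≤ 1 := pow_le_one₀ (by norm_num) (by norm_num)
  have hterm : ∀ (δ : ℝ) (v : ℤ) (a b : ℝ), IntervalIntegrable
      (fun y => nearInt δ (2 * ((c - y) - v * (d - y ^ k)))) volume a b := fun δ v a b =>
    intervalIntegrable_nearInt_comp δ (g := fun y => 2 * ((c - y) - v * (d - y ^ k)))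
      (by fun_prop) a b
  set f : ℝ → ℝ := fun y => ∑ v ∈ Finset.Icc (-(2 * N : ℤ)) (2 * N),
    ∑ m ∈ Finset.Icc 1 (2 * N + 1), nearInt (1 / m) (2 * ((c - y) - v * (d - y ^ k))) with hf
  have hfm : ∀ (v : ℤ) (a b : ℝ), IntervalIntegrable (fun y => ∑ m ∈ Finset.Icc 1 (2 * N + 1),
      nearInt (1 / m) (2 * ((c - y) - v * (d - y ^ k)))) volume a b := fun v a b =>
    intervalIntegrable_finsetSum (Finset.Icc 1 (2 * N + 1)) (fun m _ => hterm (1 / (m : ℕ)) v a b)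
  have hfi : ∀ a b, IntervalIntegrable f volume a b := fun a b =>
    intervalIntegrable_finsetSum (Finset.Icc (-(2 * N : ℤ)) (2 * N)) (fun v _ => hfm v a b)
  have hsmall : ∫ y in (0 : ℝ)..r₀, f y ≤ 100 * N * L := by
    rw [hf, intervalIntegral.integral_finsetSum fun v _ => hfm v _ _]
    calc ∑ v ∈ Finset.Icc (-(2 * N : ℤ)) (2 * N), ∫ y in (0 : ℝ)..r₀,
          ∑ m ∈ Finset.Icc 1 (2 * N + 1), nearInt (1 / m) (2 * ((c - y) - v * (d - y ^ k)))
        ≤ ∑ v ∈ Finset.Icc (-(2 * N : ℤ)) (2 * N), 20 * L := by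
          refine Finset.sum_le_sum fun v hv => ?_
          rw [intervalIntegral.integral_finsetSum fun m _ => hterm _ v _ _]
          calc _ ≤ ∑ m ∈ Finset.Icc 1 (2 * N + 1), 20 * (1 / (m : ℝ)) := by
                refine Finset.sum_le_sum fun m hm => ?_
                rw [mul_one_div]
                exact integral_nearInt_le_of_small hr₀0.le hr₀1 hJ1 c d hv (Finset.mem_Icc.mp hm).1
            _ ≤ _ := by rw [← Finset.mul_sum]; gcongr
      _ = (4 * N + 1) * (20 * L) := by
          rw [Finset.sum_const, Int.card_Icc, nsmul_eq_mul]
          congr 1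
          have : (((2 * N + 1 - -(2 * N) : ℤ).toNat : ℕ) : ℤ) = 4 * N + 1 := by omega
          exact_mod_cast this
      _ ≤ 100 * N * L := by nlinarith
  have hpow : ∀ (m w : ℕ) (a b : ℝ), IntervalIntegrable
      (fun y => nearInt (2 * (1 / m)) (2 * w * (d - y ^ k))) volume a b := fun m w a b =>
    intervalIntegrable_nearInt_comp _ (g := fun y => 2 * w * (d - y ^ k)) (by fun_prop) a b
  have hpows : ∀ (m : ℕ) (a b : ℝ), IntervalIntegrable
      (fun y => ∑ w ∈ Finset.Icc 1 (4 * N), nearInt (2 * (1 / m)) (2 * w * (d - y ^ k)))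
      volume a b := fun m a b =>
    intervalIntegrable_finsetSum (Finset.Icc 1 (4 * N)) (fun w _ => hpow m w a b)
  have hpows1 : ∀ (m : ℕ) (a b : ℝ), IntervalIntegrable
      (fun y => 1 + ∑ w ∈ Finset.Icc 1 (4 * N), nearInt (2 * (1 / m)) (2 * w * (d - y ^ k)))
      volume a b := fun m a b => intervalIntegrable_const.add (hpows m a b)
  have hbig : ∀ r : ℝ, r₀ ≤ r → 2 * r ≤ 1 → ∫ y in r..2 * r, f y ≤ B * N * L ^ 2 := by
    intro r hr hr1
    have hr0 : 0 < r := hr₀0.trans_le hr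
    have hrk : 1 / r ^ (k - 1) ≤ 4 * N * k * 2 ^ k := by
      refine le_trans ?_ hJ2
      gcongr
    have hle : ∀ y, f y ≤ ∑ m ∈ Finset.Icc 1 (2 * N + 1),
        (1 + ∑ w ∈ Finset.Icc 1 (4 * N), nearInt (2 * (1 / m)) (2 * w * (d - y ^ k))) := by
      intro y
      rw [hf]
      simp only
      rw [Finset.sum_comm]
      exact Finset.sum_le_sum fun m _ => sum_nearInt_le N _ _ _
    calc ∫ y in r..2 * r, f y
        ≤ ∫ y in r..2 * r, ∑ m ∈ Finset.Icc 1 (2 * N + 1),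
          (1 + ∑ w ∈ Finset.Icc 1 (4 * N), nearInt (2 * (1 / m)) (2 * w * (d - y ^ k))) := by
          refine intervalIntegral.integral_mono (by linarith) (hfi _ _) ?_ hle
          exact intervalIntegrable_finsetSum (Finset.Icc 1 (2 * N + 1))
            (fun m _ => hpows1 m r (2 * r))
      _ = ∑ m ∈ Finset.Icc 1 (2 * N + 1), ∫ y in r..2 * r,
          (1 + ∑ w ∈ Finset.Icc 1 (4 * N), nearInt (2 * (1 / m)) (2 * w * (d - y ^ k))) :=
          intervalIntegral.integral_finsetSum fun m _ => hpows1 m _ _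
      _ ≤ ∑ m ∈ Finset.Icc 1 (2 * N + 1),
          (1 + (2 ^ (k + 1) * (4 * N) + 48 * N * k * 2 ^ k * L) * (1 / (m : ℝ))) := by
          refine Finset.sum_le_sum fun m hm => ?_
          rw [intervalIntegral.integral_add intervalIntegrable_const (hpows m _ _),
            intervalIntegral.integral_finsetSum fun w _ => hpow m w _ _,
            intervalIntegral.integral_const, smul_eq_mul, mul_one]
          refine add_le_add (by linarith) ?_
          calc _ ≤ ∑ w ∈ Finset.Icc 1 (4 * N),
                (2 ^ (k + 1) + 48 * N * k * 2 ^ k * (1 / (w : ℝ))) * (1 / (m : ℝ)) := by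
                refine Finset.sum_le_sum fun w hw => ?_
                refine (integral_nearInt_pow_le (by omega) hr0 hr1 d (Finset.mem_Icc.mp hw).1
                  (Finset.mem_Icc.mp hm).1).trans ?_
                rw [div_eq_mul_one_div _ (m : ℝ)]
                gcongr
                calc 12 / (w * r ^ (k - 1)) = 12 * (1 / r ^ (k - 1)) * (1 / (w : ℝ)) := by
                      field_simp
                  _ ≤ 12 * (4 * N * k * 2 ^ k) * (1 / (w : ℝ)) := by gcongr
                  _ = _ := by ring
            _ = (2 ^ (k + 1) * (4 * N) + 48 * N * k * 2 ^ k *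
                  ∑ w ∈ Finset.Icc 1 (4 * N), 1 / (w : ℝ)) * (1 / (m : ℝ)) := by
                rw [← Finset.sum_mul, Finset.sum_add_distrib, ← Finset.mul_sum]
                simp only [Finset.sum_const, Nat.card_Icc, nsmul_eq_mul]
                push_cast
                ring
            _ ≤ _ := by gcongr
      _ = (2 * N + 1) + (2 ^ (k + 1) * (4 * N) + 48 * N * k * 2 ^ k * L) *
          ∑ m ∈ Finset.Icc 1 (2 * N + 1), 1 / (m : ℝ) := by
          rw [Finset.sum_add_distrib, ← Finset.mul_sum]
          simp
      _ ≤ 3 * N * L ^ 2 + (2 ^ (k + 1) * (4 * N) * L + 48 * N * k * 2 ^ k * L) * L := by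
          have hL2 : 1 ≤ L ^ 2 := one_le_pow₀ hL1
          have h1 : (2 : ℝ) ^ (k + 1) * (4 * N) ≤ 2 ^ (k + 1) * (4 * N) * L :=
            le_mul_of_one_le_right (by positivity) hL1
          refine add_le_add (by nlinarith) ?_
          gcongr
      _ = B * N * L ^ 2 := by
          rw [hB]
          ring
  have hsplit : ∫ y in (0 : ℝ)..1, f y =
      (∫ y in (0 : ℝ)..r₀, f y) + ∑ j ∈ Finset.range J, ∫ y in 2 ^ j * r₀..2 ^ (j + 1) * r₀, f y := by
    rw [intervalIntegral.sum_integral_adjacent_intervals (a := fun j => 2 ^ j * r₀)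
      fun j _ => hfi _ _]
    have h1 : (2 : ℝ) ^ J * r₀ = 1 := by
      rw [hr₀, ← mul_pow]
      norm_num
    rw [h1, pow_zero, one_mul, intervalIntegral.integral_add_adjacent_intervals (hfi _ _) (hfi _ _)]
  rw [hsplit]
  have hsum : ∑ j ∈ Finset.range J, ∫ y in 2 ^ j * r₀..2 ^ (j + 1) * r₀, f y ≤
      J * (B * N * L ^ 2) := by
    calc _ ≤ ∑ j ∈ Finset.range J, B * N * L ^ 2 := by
          refine Finset.sum_le_sum fun j hj => ?_
          have h1 : (2 : ℝ) ^ (j + 1) * r₀ = 2 * (2 ^ j * r₀) := by ring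
          rw [h1]
          refine hbig _ ?_ ?_
          · exact le_mul_of_one_le_left hr₀0.le (one_le_pow₀ (by norm_num))
          · rw [← h1]
            have h2 : (2 : ℝ) ^ J * r₀ = 1 := by
              rw [hr₀, ← mul_pow]
              norm_num
            rw [← h2]
            gcongr
            · norm_num
            · exact Finset.mem_range.mp hj
      _ = _ := by simp
  calc _ ≤ 100 * N * L + ((3 + 2 * Real.log k) * L) * (B * N * L ^ 2) := by
        refine add_le_add hsmall (hsum.trans ?_)
        gcongr
    _ ≤ 100 * N * L ^ 3 + ((3 + 2 * Real.log k) * L) * (B * N * L ^ 2) := by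
        gcongr
        exact le_self_pow₀ hL1 (by norm_num)
    _ = _ := by ring

/-- The `L²` bound along the curve for the reproducing kernel of the Weyl sums. -/
theorem exists_integral_norm_sq_weylSum_le {k : ℕ} (hk : 2 ≤ k) :
    ∃ C > (0 : ℝ), ∀ N : ℕ, 0 < N → ∀ x : ℝ,
      ∫ y in (0 : ℝ)..1,
        ‖∑ n ∈ Finset.Icc (-(N : ℤ)) N, e (n * (x - y) - n ^ 2 * (x ^ k - y ^ k))‖ ^ 2 ≤
      C * (N * (1 + Real.log ((4 * N : ℕ) : ℝ)) ^ 3) := by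
  obtain ⟨C, hC, h⟩ := exists_integral_sum_nearInt_le hk
  refine ⟨5 + C, by positivity, fun N hN x => ?_⟩
  set L := 1 + Real.log ((4 * N : ℕ) : ℝ) with hL
  have hL1 : 1 ≤ L := by
    have := Real.log_natCast_nonneg (4 * N)
    linarith
  have hN1 : (1 : ℝ) ≤ N := by exact_mod_cast hN
  have hterm : ∀ (m : ℕ) (v : ℤ), IntervalIntegrable
      (fun y => nearInt (1 / m) (2 * ((x - y) - v * (x ^ k - y ^ k)))) volume 0 1 := fun m v =>
    intervalIntegrable_nearInt_comp _ (g := fun y => 2 * ((x - y) - v * (x ^ k - y ^ k)))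
      (by fun_prop) 0 1
  have hfi : IntervalIntegrable (fun y => ∑ v ∈ Finset.Icc (-(2 * N : ℤ)) (2 * N),
      ∑ m ∈ Finset.Icc 1 (2 * N + 1), nearInt (1 / m) (2 * ((x - y) - v * (x ^ k - y ^ k))))
      volume 0 1 :=
    intervalIntegrable_finsetSum (Finset.Icc (-(2 * N : ℤ)) (2 * N)) (fun v _ =>
      intervalIntegrable_finsetSum (Finset.Icc 1 (2 * N + 1)) (fun m _ => hterm m v))
  calc _ ≤ ∫ y in (0 : ℝ)..1, ((4 * N + 1 : ℝ) + ∑ v ∈ Finset.Icc (-(2 * N : ℤ)) (2 * N),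
        ∑ m ∈ Finset.Icc 1 (2 * N + 1), nearInt (1 / m) (2 * ((x - y) - v * (x ^ k - y ^ k)))) := by
        refine intervalIntegral.integral_mono zero_le_one ?_ (intervalIntegrable_const.add hfi) ?_
        · refine Continuous.intervalIntegrable ?_ _ _
          have := continuous_e
          fun_prop
        · intro y
          refine (norm_sq_weylSum_le N (x - y) (x ^ k - y ^ k)).trans ?_
          rw [Finset.sum_add_distrib]
          refine add_le_add ?_ le_rfl
          rw [Finset.sum_const, Int.card_Icc, nsmul_eq_mul, mul_one]
          have : (((2 * N + 1 - -(2 * N) : ℤ).toNat : ℕ) : ℤ) ≤ 4 * N + 1 := by omega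
          exact_mod_cast this
    _ ≤ (4 * N + 1) + C * (N * L ^ 3) := by
        rw [intervalIntegral.integral_add intervalIntegrable_const hfi]
        refine add_le_add (by simp) (h N hN x (x ^ k))
    _ ≤ _ := by
        have : 1 ≤ L ^ 3 := one_le_pow₀ hL1
        nlinarith

/-- The `TT*` method: an `L²` bound for the kernel `∑ ψ i x * conj (ψ i y)`, uniform in `x`, yields
an `ℓ² → L⁴` bound for `a ↦ ∑ a i * ψ i`. -/
theorem integral_norm_sum_pow_four_le {ι : Type*} (s : Finset ι) (a : ι → ℂ) {ψ : ι → ℝ → ℂ}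
    (hψ : ∀ i, Continuous (ψ i)) {M : ℝ}
    (hM : ∀ x, ∫ y in (0 : ℝ)..1, ‖∑ i ∈ s, ψ i x * (starRingEnd ℂ) (ψ i y)‖ ^ 2 ≤ M) :
    ∫ x in (0 : ℝ)..1, ‖∑ i ∈ s, a i * ψ i x‖ ^ 4 ≤ (∑ i ∈ s, ‖a i‖ ^ 2) ^ 2 * M := by
  set F : ℝ → ℂ := fun x => ∑ i ∈ s, a i * ψ i x with hF
  have hFc : Continuous F := by fun_prop
  set h : ℝ → ℂ := fun x => (starRingEnd ℂ) (F x) * (‖F x‖ ^ 2 : ℝ) with hh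
  have hhc : Continuous h := by
    have := RCLike.continuous_conj (K := ℂ)
    fun_prop
  have hhn : ∀ x, ‖h x‖ = ‖F x‖ ^ 3 := fun x => by
    rw [hh]
    simp only [norm_mul, RCLike.norm_conj, Complex.norm_real, Real.norm_eq_abs]
    rw [abs_of_nonneg (by positivity)]
    ring
  set K : ℝ → ℝ → ℂ := fun x y => ∑ i ∈ s, ψ i x * (starRingEnd ℂ) (ψ i y) with hK
  have hKc : Continuous (Function.uncurry K) := by
    have := RCLike.continuous_conj (K := ℂ)
    simp only [hK, Function.uncurry_def]
    fun_prop
  have hKc' : Continuous fun p : ℝ × ℝ => K p.1 p.2 := hKc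
  have hKsymm : ∀ x y, ‖K x y‖ = ‖K y x‖ := fun x y => by
    rw [← RCLike.norm_conj (K x y)]
    congr 1
    simp only [hK, map_sum, map_mul, Complex.conj_conj]
    exact Finset.sum_congr rfl fun i _ => mul_comm _ _
  set I := ∫ x in (0 : ℝ)..1, ‖F x‖ ^ 4 with hI
  set A := ∑ i ∈ s, ‖a i‖ ^ 2 with hA
  set b : ι → ℂ := fun i => ∫ x in (0 : ℝ)..1, ψ i x * h x with hb
  have hI0 : 0 ≤ I := intervalIntegral.integral_nonneg zero_le_one fun _ _ => by positivity
  have hA0 : 0 ≤ A := Finset.sum_nonneg fun _ _ => by positivity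
  have hM0 : 0 ≤ M := le_trans
    (intervalIntegral.integral_nonneg zero_le_one fun _ _ => by positivity) (hM 0)
  have hIb : (I : ℂ) = ∑ i ∈ s, a i * b i := by
    rw [hI, ← intervalIntegral.integral_ofReal]
    have h1 : ∀ x, ((‖F x‖ ^ 4 : ℝ) : ℂ) = ∑ i ∈ s, a i * (ψ i x * h x) := by
      intro x
      have h2 : ∑ i ∈ s, a i * (ψ i x * h x) = F x * h x := by
        simp only [hF, Finset.sum_mul, mul_assoc]
      rw [h2, hh]
      simp only
      rw [← mul_assoc, Complex.mul_conj']
      push_cast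
      ring
    simp_rw [h1]
    rw [intervalIntegral.integral_finsetSum fun i _ =>
      Continuous.intervalIntegrable (by have := hψ i; fun_prop) _ _]
    simp only [hb, intervalIntegral.integral_const_mul]
  have hIA : I ^ 2 ≤ A * ∑ i ∈ s, ‖b i‖ ^ 2 := by
    have h1 : I ≤ ∑ i ∈ s, ‖a i‖ * ‖b i‖ := by
      have h2 := congrArg norm hIb
      rw [Complex.norm_real, Real.norm_of_nonneg hI0] at h2
      rw [h2]
      refine (norm_sum_le _ _).trans (le_of_eq ?_)
      simp
    exact (pow_le_pow_left₀ hI0 h1 2).trans (Finset.sum_mul_sq_le_sq_mul_sq _ _ _)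
  have hBeq : ((∑ i ∈ s, ‖b i‖ ^ 2 : ℝ) : ℂ) =
      ∫ x in (0 : ℝ)..1, ∫ y in (0 : ℝ)..1, h x * (starRingEnd ℂ) (h y) * K x y := by
    have hc := RCLike.continuous_conj (K := ℂ)
    have h1 : ∀ i, ((‖b i‖ ^ 2 : ℝ) : ℂ) = ∫ x in (0 : ℝ)..1, ∫ y in (0 : ℝ)..1,
        (ψ i x * h x) * (starRingEnd ℂ) (ψ i y * h y) := by
      intro i
      simp only [intervalIntegral.integral_const_mul, intervalIntegral.integral_mul_const]
      rw [intervalIntegral.integral_of_le (f := fun y => (starRingEnd ℂ) (ψ i y * h y)) zero_le_one,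
        integral_conj, ← intervalIntegral.integral_of_le zero_le_one, Complex.mul_conj']
      push_cast
      rfl
    push_cast
    have h2 : ∀ i ∈ s, (‖b i‖ : ℂ) ^ 2 = ∫ x in (0 : ℝ)..1, ∫ y in (0 : ℝ)..1,
        (ψ i x * h x) * (starRingEnd ℂ) (ψ i y * h y) := fun i _ => by
      rw [← h1 i]
      push_cast
      rfl
    rw [Finset.sum_congr rfl h2, ← intervalIntegral.integral_finsetSum]
    · refine intervalIntegral.integral_congr fun x _ => ?_
      rw [← intervalIntegral.integral_finsetSum]
      · refine intervalIntegral.integral_congr fun y _ => ?_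
        simp only [hK, Finset.mul_sum, map_mul]
        exact Finset.sum_congr rfl fun i _ => by ring
      · intro i _
        have := hψ i
        exact Continuous.intervalIntegrable (by fun_prop) _ _
    · intro i _
      have := hψ i
      exact Continuous.intervalIntegrable (by fun_prop) _ _
  have hBle : ∀ t : ℝ, 0 < t →
      ∑ i ∈ s, ‖b i‖ ^ 2 ≤ (t * I ^ 2 + t⁻¹ * (I * M)) / 2 := by
    intro t ht
    have h1 := congrArg norm hBeq
    rw [Complex.norm_real, Real.norm_of_nonneg (Finset.sum_nonneg fun _ _ => by positivity)] at h1
    have hpt : ∀ x y, ‖h x * (starRingEnd ℂ) (h y) * K x y‖ ≤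
        t / 2 * (‖F x‖ ^ 4 * ‖F y‖ ^ 4) +
          (t⁻¹ / 4 * (‖F x‖ ^ 4 * ‖K x y‖ ^ 2) + t⁻¹ / 4 * (‖F y‖ ^ 4 * ‖K x y‖ ^ 2)) := by
      intro x y
      rw [norm_mul, norm_mul, RCLike.norm_conj, hhn, hhn]
      set u := ‖F x‖
      set w := ‖F y‖
      set κ := ‖K x y‖
      have e1 : 0 ≤ (t * u ^ 2 * w ^ 2 - u * w * κ) ^ 2 := sq_nonneg _
      have e2 : 0 ≤ (u ^ 2 - w ^ 2) ^ 2 * κ ^ 2 := by positivity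
      have e3 : t * t⁻¹ = 1 := mul_inv_cancel₀ ht.ne'
      have e4 : 0 ≤ t⁻¹ := by positivity
      have e5 := mul_nonneg e4 e1
      have e6 := mul_nonneg e4 e2
      have e7 : t⁻¹ * (t * u ^ 2 * w ^ 2 - u * w * κ) ^ 2 =
          t * u ^ 4 * w ^ 4 - 2 * (u ^ 3 * w ^ 3 * κ) + t⁻¹ * (u ^ 2 * w ^ 2 * κ ^ 2) := by
        linear_combination (u ^ 4 * w ^ 4 * t - 2 * (u ^ 3 * w ^ 3 * κ)) * e3
      nlinarith
    have c1 : Continuous fun p : ℝ × ℝ => ‖F p.1‖ ^ 4 * ‖F p.2‖ ^ 4 := by fun_prop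
    have c2 : Continuous fun p : ℝ × ℝ => ‖F p.1‖ ^ 4 * ‖K p.1 p.2‖ ^ 2 := by fun_prop
    have c3 : Continuous fun p : ℝ × ℝ => ‖F p.2‖ ^ 4 * ‖K p.1 p.2‖ ^ 2 := by fun_prop
    have c4 : Continuous fun p : ℝ × ℝ => ‖h p.1 * (starRingEnd ℂ) (h p.2) * K p.1 p.2‖ := by
      have := RCLike.continuous_conj (K := ℂ)
      fun_prop
    have c5 : Continuous fun p : ℝ × ℝ => t / 2 * (‖F p.1‖ ^ 4 * ‖F p.2‖ ^ 4) +
        (t⁻¹ / 4 * (‖F p.1‖ ^ 4 * ‖K p.1 p.2‖ ^ 2) +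
          t⁻¹ / 4 * (‖F p.2‖ ^ 4 * ‖K p.1 p.2‖ ^ 2)) := by fun_prop
    have slice : ∀ {G : ℝ × ℝ → ℝ}, Continuous G → ∀ x,
        IntervalIntegrable (fun y => G (x, y)) volume 0 1 := fun hG x =>
      (hG.comp (by fun_prop : Continuous fun y : ℝ => (x, y))).intervalIntegrable _ _
    have outer : ∀ {G : ℝ × ℝ → ℝ}, Continuous G →
        IntervalIntegrable (fun x => ∫ y in (0 : ℝ)..1, G (x, y)) volume 0 1 := fun {G} hG =>
      (intervalIntegral.continuous_parametric_intervalIntegral_of_continuous'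
        (f := fun x y => G (x, y)) hG 0 1).intervalIntegrable _ _
    have hadd : ∀ {G H : ℝ → ℝ → ℝ}, (Continuous fun p : ℝ × ℝ => G p.1 p.2) →
        (Continuous fun p : ℝ × ℝ => H p.1 p.2) →
        ∫ x in (0 : ℝ)..1, ∫ y in (0 : ℝ)..1, (G x y + H x y) =
        (∫ x in (0 : ℝ)..1, ∫ y in (0 : ℝ)..1, G x y) +
          ∫ x in (0 : ℝ)..1, ∫ y in (0 : ℝ)..1, H x y := fun hG hH => by
      rw [← intervalIntegral.integral_add (outer hG) (outer hH)]
      refine intervalIntegral.integral_congr fun x _ => ?_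
      exact intervalIntegral.integral_add (slice hG x) (slice hH x)
    have hrow : ∫ x in (0 : ℝ)..1, ∫ y in (0 : ℝ)..1, ‖F x‖ ^ 4 * ‖K x y‖ ^ 2 ≤ I * M := by
      rw [hI, ← intervalIntegral.integral_mul_const]
      refine intervalIntegral.integral_mono zero_le_one (outer c2)
        (Continuous.intervalIntegrable (by fun_prop) _ _) fun x => ?_
      simp only [intervalIntegral.integral_const_mul]
      exact mul_le_mul_of_nonneg_left (hM x) (by positivity)
    have hcol : ∫ x in (0 : ℝ)..1, ∫ y in (0 : ℝ)..1, ‖F y‖ ^ 4 * ‖K x y‖ ^ 2 ≤ I * M := by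
      rw [intervalIntegral_intervalIntegral_swap]
      · simp_rw [fun x y => hKsymm x y] at hrow ⊢
        exact hrow
      · refine (Continuous.integrableOn_Icc c3 (a := (0, 0)) (b := (1, 1))).mono_set ?_
        rw [← Set.Icc_prod_Icc, Set.uIoc_of_le zero_le_one]
        exact Set.prod_mono Set.Ioc_subset_Icc_self Set.Ioc_subset_Icc_self
    have hsq : ∫ x in (0 : ℝ)..1, ∫ y in (0 : ℝ)..1, ‖F x‖ ^ 4 * ‖F y‖ ^ 4 = I ^ 2 := by
      simp only [intervalIntegral.integral_const_mul, intervalIntegral.integral_mul_const]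
      rw [sq]
    calc ∑ i ∈ s, ‖b i‖ ^ 2
        = ‖∫ x in (0 : ℝ)..1, ∫ y in (0 : ℝ)..1, h x * (starRingEnd ℂ) (h y) * K x y‖ := h1
      _ ≤ ∫ x in (0 : ℝ)..1, ‖∫ y in (0 : ℝ)..1, h x * (starRingEnd ℂ) (h y) * K x y‖ :=
          intervalIntegral.norm_integral_le_integral_norm zero_le_one
      _ ≤ ∫ x in (0 : ℝ)..1, ∫ y in (0 : ℝ)..1, (t / 2 * (‖F x‖ ^ 4 * ‖F y‖ ^ 4) +
          (t⁻¹ / 4 * (‖F x‖ ^ 4 * ‖K x y‖ ^ 2) + t⁻¹ / 4 * (‖F y‖ ^ 4 * ‖K x y‖ ^ 2))) := by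
          refine intervalIntegral.integral_mono zero_le_one ?_ (outer c5) fun x => ?_
          · have := RCLike.continuous_conj (K := ℂ)
            exact Continuous.intervalIntegrable (by fun_prop) _ _
          · refine (intervalIntegral.norm_integral_le_integral_norm zero_le_one).trans ?_
            have s4 := slice c4 x
            have s5 := slice c5 x
            exact intervalIntegral.integral_mono zero_le_one s4 s5 fun y => hpt x y
      _ = t / 2 * I ^ 2 +
          (t⁻¹ / 4 * (∫ x in (0 : ℝ)..1, ∫ y in (0 : ℝ)..1, ‖F x‖ ^ 4 * ‖K x y‖ ^ 2) +
          t⁻¹ / 4 * ∫ x in (0 : ℝ)..1, ∫ y in (0 : ℝ)..1, ‖F y‖ ^ 4 * ‖K x y‖ ^ 2) := by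
          rw [hadd (by fun_prop) (by fun_prop), hadd (by fun_prop) (by fun_prop), ← hsq]
          simp only [intervalIntegral.integral_const_mul]
      _ ≤ t / 2 * I ^ 2 + (t⁻¹ / 4 * (I * M) + t⁻¹ / 4 * (I * M)) := by gcongr
      _ = _ := by ring
  rcases hA0.eq_or_lt with hA00 | hApos
  · rw [← hA00, zero_mul] at hIA
    have : I = 0 := by nlinarith
    rw [this]
    positivity
  have h1 := hIA.trans (mul_le_mul_of_nonneg_left (hBle A⁻¹ (by positivity)) hA0)
  rw [inv_inv] at h1
  have h2 : A * ((A⁻¹ * I ^ 2 + A * (I * M)) / 2) = (I ^ 2 + A ^ 2 * (I * M)) / 2 := by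
    field_simp
  rw [h2] at h1
  rcases hI0.eq_or_lt with hI00 | hIpos
  · rw [← hI00]
    positivity
  have h3 : I * I ≤ A ^ 2 * M * I := by linarith
  exact le_of_mul_le_mul_right h3 hIpos

theorem sum_Icc_comp_neg {E : Type*} [AddCommMonoid E] (N : ℕ) (f : ℤ → E) :
    ∑ n ∈ Finset.Icc (-(N : ℤ)) N, f (-n) = ∑ n ∈ Finset.Icc (-(N : ℤ)) N, f n :=
  Finset.sum_equiv (Equiv.neg ℤ) (fun n => by simp; omega) fun n _ => rfl

theorem exists_norm_weylSum_neg_eq (k N : ℕ) (a : ℤ → ℂ) :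
    ∃ a' : ℤ → ℂ, (∑ n ∈ Finset.Icc (-(N : ℤ)) N, ‖a' n‖ ^ 2 =
        ∑ n ∈ Finset.Icc (-(N : ℤ)) N, ‖a n‖ ^ 2) ∧
      ∀ x : ℝ, ‖∑ n ∈ Finset.Icc (-(N : ℤ)) N, a n * e (n * (-x) - n ^ 2 * (-x) ^ k)‖ =
        ‖∑ n ∈ Finset.Icc (-(N : ℤ)) N, a' n * e (n * x - n ^ 2 * x ^ k)‖ := by
  rcases Nat.even_or_odd k with hk | hk
  · refine ⟨fun n => a (-n), sum_Icc_comp_neg N fun n => ‖a n‖ ^ 2, fun x => ?_⟩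
    rw [← sum_Icc_comp_neg N fun n => a n * e (n * (-x) - n ^ 2 * (-x) ^ k)]
    simp [hk.neg_pow]
  · refine ⟨fun n => (starRingEnd ℂ) (a n), by simp, fun x => ?_⟩
    rw [← RCLike.norm_conj, map_sum]
    simp only [map_mul, conj_e, hk.neg_pow]
    congr 1
    refine Finset.sum_congr rfl fun n _ => ?_
    congr 2
    ring

theorem exists_integral_norm_weylSum_pow_four_le {k : ℕ} (hk : 2 ≤ k) :
    ∃ C > (0 : ℝ), ∀ N : ℕ, 0 < N → ∀ a : ℤ → ℂ,
      ∫ x in (-1 : ℝ)..1,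
        ‖∑ n ∈ Finset.Icc (-(N : ℤ)) N, a n * e (n * x - n ^ 2 * x ^ k)‖ ^ 4 ≤
      (∑ n ∈ Finset.Icc (-(N : ℤ)) N, ‖a n‖ ^ 2) ^ 2 *
        (C * (N * (1 + Real.log ((4 * N : ℕ) : ℝ)) ^ 3)) := by
  obtain ⟨C, hC, hker⟩ := exists_integral_norm_sq_weylSum_le hk
  have hec := continuous_e
  refine ⟨2 * C, by positivity, fun N hN a => ?_⟩
  have half : ∀ a : ℤ → ℂ, ∫ x in (0 : ℝ)..1,
      ‖∑ n ∈ Finset.Icc (-(N : ℤ)) N, a n * e (n * x - n ^ 2 * x ^ k)‖ ^ 4 ≤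
      (∑ n ∈ Finset.Icc (-(N : ℤ)) N, ‖a n‖ ^ 2) ^ 2 *
        (C * (N * (1 + Real.log ((4 * N : ℕ) : ℝ)) ^ 3)) := by
    intro a
    refine integral_norm_sum_pow_four_le _ a (ψ := fun (n : ℤ) x => e (n * x - n ^ 2 * x ^ k))
      (fun n => by fun_prop) fun x => ?_
    refine le_of_eq_of_le ?_ (hker N hN x)
    refine intervalIntegral.integral_congr fun y _ => ?_
    congr 2
    refine Finset.sum_congr rfl fun n _ => ?_
    rw [conj_e, ← e_add]
    congr 1
    ring
  obtain ⟨a', ha', hneg⟩ := exists_norm_weylSum_neg_eq k N a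
  have hleft := half a'
  simp_rw [ha', ← hneg] at hleft
  rw [intervalIntegral.integral_comp_neg fun x =>
    ‖∑ n ∈ Finset.Icc (-(N : ℤ)) N, a n * e (n * x - n ^ 2 * x ^ k)‖ ^ 4, neg_zero] at hleft
  rw [← intervalIntegral.integral_add_adjacent_intervals (b := 0)
    (Continuous.intervalIntegrable (by fun_prop) _ _)
    (Continuous.intervalIntegrable (by fun_prop) _ _)]
  have := half a
  linarith

theorem one_add_log_four_mul_pow_three_le {η : ℝ} (hη : 0 < η) :
    ∃ D > (0 : ℝ), ∀ N : ℕ, 0 < N → (1 + Real.log ((4 * N : ℕ) : ℝ)) ^ 3 ≤ D * (N : ℝ) ^ η := by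
  have hη3 : 0 < η / 3 := by positivity
  refine ⟨(1 + 4 ^ (η / 3) / (η / 3)) ^ 3, by positivity, fun N hN => ?_⟩
  have hN1 : (1 : ℝ) ≤ N := by exact_mod_cast hN
  have h1 := Real.log_le_rpow_div (x := ((4 * N : ℕ) : ℝ)) (by positivity) hη3
  have h2 : 1 ≤ (N : ℝ) ^ (η / 3) := Real.one_le_rpow hN1 hη3.le
  have h0 := Real.log_natCast_nonneg (4 * N)
  have h3 : 1 + Real.log ((4 * N : ℕ) : ℝ) ≤ (1 + 4 ^ (η / 3) / (η / 3)) * (N : ℝ) ^ (η / 3) := by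
    have h4 : (((4 * N : ℕ) : ℝ)) ^ (η / 3) = 4 ^ (η / 3) * (N : ℝ) ^ (η / 3) := by
      push_cast
      rw [Real.mul_rpow (by norm_num) (by positivity)]
    rw [h4] at h1
    calc _ ≤ (N : ℝ) ^ (η / 3) + 4 ^ (η / 3) * (N : ℝ) ^ (η / 3) / (η / 3) := add_le_add h2 h1
      _ = _ := by ring
  calc _ ≤ ((1 + 4 ^ (η / 3) / (η / 3)) * (N : ℝ) ^ (η / 3)) ^ 3 := by gcongr
    _ = (1 + 4 ^ (η / 3) / (η / 3)) ^ 3 * (N : ℝ) ^ η := by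
      rw [mul_pow, ← Real.rpow_mul_natCast (by positivity)]
      congr 2
      push_cast
      ring

theorem norm_weylSum_le {N : ℕ} (hN : 0 < N) (a : ℤ → ℂ) (φ : ℤ → ℝ) :
    ‖∑ n ∈ Finset.Icc (-(N : ℤ)) N, a n * e (φ n)‖ ≤
      Real.sqrt (∑ n ∈ Finset.Icc (-(N : ℤ)) N, ‖a n‖ ^ 2) * Real.sqrt (3 * N) := by
  rw [← Real.sqrt_mul (Finset.sum_nonneg fun _ _ => by positivity)]
  refine Real.le_sqrt_of_sq_le ?_
  have h1 : ‖∑ n ∈ Finset.Icc (-(N : ℤ)) N, a n * e (φ n)‖ ≤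
      ∑ n ∈ Finset.Icc (-(N : ℤ)) N, ‖a n‖ * 1 := by
    refine (norm_sum_le _ _).trans (le_of_eq ?_)
    simp [norm_e]
  refine (pow_le_pow_left₀ (norm_nonneg _) h1 2).trans
    ((Finset.sum_mul_sq_le_sq_mul_sq _ _ _).trans ?_)
  refine mul_le_mul_of_nonneg_left ?_ (Finset.sum_nonneg fun _ _ => by positivity)
  simp only [one_pow, Finset.sum_const, Int.card_Icc, nsmul_eq_mul, mul_one]
  have : (((N + 1 - -N : ℤ).toNat : ℕ) : ℤ) ≤ 3 * N := by omega
  exact_mod_cast this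

/-- Interpolation between a uniform bound and an `L⁴` bound. -/
theorem eLpNorm_le_of_integral_pow_four_le {f : ℝ → ℂ} (hf : Continuous f) {p S R : ℝ}
    (hp : 4 ≤ p) (hR : 0 ≤ R) (hS : ∀ x, ‖f x‖ ≤ S)
    (h4 : S ^ (p - 4) * ∫ x in (-1 : ℝ)..1, ‖f x‖ ^ 4 ≤ R ^ p) :
    eLpNorm f (ENNReal.ofReal p) (volume.restrict (Set.Ioo (-1) 1)) ≤ ENNReal.ofReal R := by
  have hp0 : 0 < p := by linarith
  rw [eLpNorm_eq_lintegral_rpow_enorm_toReal (by simpa using hp0) ENNReal.ofReal_ne_top,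
    ENNReal.toReal_ofReal hp0.le, one_div, ENNReal.rpow_inv_le_iff hp0,
    ENNReal.ofReal_rpow_of_nonneg hR hp0.le]
  calc ∫⁻ x in Set.Ioo (-1 : ℝ) 1, ‖f x‖ₑ ^ p
      ≤ ∫⁻ x in Set.Ioo (-1 : ℝ) 1, ENNReal.ofReal (S ^ (p - 4) * ‖f x‖ ^ 4) := by
        refine lintegral_mono fun x => ?_
        rw [← ofReal_norm, ENNReal.ofReal_rpow_of_nonneg (norm_nonneg _) hp0.le]
        refine ENNReal.ofReal_le_ofReal ?_
        have h1 : ‖f x‖ ^ p = ‖f x‖ ^ (p - 4) * ‖f x‖ ^ 4 := by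
          rw [← Real.rpow_natCast ‖f x‖ 4, ← Real.rpow_add_of_nonneg (norm_nonneg _) (by linarith)
            (by norm_num)]
          norm_num
        rw [h1]
        have := Real.rpow_le_rpow (norm_nonneg _) (hS x) (show 0 ≤ p - 4 by linarith)
        gcongr
    _ = ENNReal.ofReal (∫ x in Set.Ioo (-1 : ℝ) 1, S ^ (p - 4) * ‖f x‖ ^ 4) := by
        have hS0 : 0 ≤ S := (norm_nonneg _).trans (hS 0)
        rw [ofReal_integral_eq_lintegral_ofReal]
        · exact (Continuous.integrableOn_Icc (by fun_prop)).mono_set Set.Ioo_subset_Icc_self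
        · exact Filter.Eventually.of_forall fun x => by positivity
    _ ≤ _ := by
        refine ENNReal.ofReal_le_ofReal ?_
        rw [integral_const_mul, ← integral_Ioc_eq_integral_Ioo,
          ← intervalIntegral.integral_of_le (by norm_num)]
        exact h4

/-- **Theorem 13, range `p ≥ 4`.** For `k ≥ 2`, real `p ≥ 4` and `ε > 0` there is
`C_ε > 0` such that for every `N ≥ 1` and all `(a_n)_{n=-N}^N`,
`‖∑ a_n e(nx − n²xᵏ)‖_{L^p(-1,1)} ≤ C_ε N^{1/2 − 1/p + ε} (∑ |a_n|²)^{1/2}`. -/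
theorem stmt16 (k : ℕ) (hk : 2 ≤ k) (p : ℝ) (hp : 4 ≤ p) :
    ∀ ε > (0:ℝ), ∃ Cε > (0:ℝ), ∀ N : ℕ, 0 < N → ∀ a : ℤ → ℂ,
      eLpNorm (fun x : ℝ =>
          ∑ n ∈ Finset.Icc (-(N:ℤ)) (N:ℤ), a n * e ((n:ℝ) * x - (n:ℝ)^2 * x^k))
        (ENNReal.ofReal p) (volume.restrict (Set.Ioo (-1) 1))
      ≤ ENNReal.ofReal
          (Cε * (N:ℝ) ^ ((1:ℝ)/2 - 1/p + ε) *
            Real.sqrt (∑ n ∈ Finset.Icc (-(N:ℤ)) (N:ℤ), ‖a n‖^2)) := by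
  intro ε hε
  have hp0 : 0 < p := by linarith
  obtain ⟨C, hC, h4⟩ := exists_integral_norm_weylSum_pow_four_le hk
  obtain ⟨D, hD, hlog⟩ := one_add_log_four_mul_pow_three_le (show 0 < ε * p by positivity)
  set Q : ℝ := Real.sqrt 3 ^ (p - 4) * C * D with hQ
  have hQ0 : 0 < Q := by positivity
  refine ⟨Q ^ (1 / p), by positivity, fun N hN a => ?_⟩
  have hN0 : (0 : ℝ) < N := by exact_mod_cast hN
  have hec := continuous_e
  set A := ∑ n ∈ Finset.Icc (-(N : ℤ)) N, ‖a n‖ ^ 2 with hA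
  have hA0 : 0 ≤ A := Finset.sum_nonneg fun _ _ => by positivity
  set s := Real.sqrt A with hs
  have hs0 : 0 ≤ s := Real.sqrt_nonneg _
  refine eLpNorm_le_of_integral_pow_four_le (S := s * Real.sqrt (3 * N)) (by fun_prop) hp
    (by positivity) (fun x => norm_weylSum_le hN a fun n => n * x - n ^ 2 * x ^ k) ?_
  have hAs : A ^ 2 = s ^ (4 : ℝ) := by
    rw [show (4 : ℝ) = (4 : ℕ) by norm_num, Real.rpow_natCast, show s ^ 4 = (s ^ 2) ^ 2 by ring,
      hs, Real.sq_sqrt hA0]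
  have hNs : Real.sqrt N ^ (p - 4) = (N : ℝ) ^ (p / 2 - 2) := by
    rw [Real.sqrt_eq_rpow, ← Real.rpow_mul hN0.le]
    congr 1
    ring
  calc _ ≤ (s * Real.sqrt (3 * N)) ^ (p - 4) * (A ^ 2 * (C * (N * (D * (N : ℝ) ^ (ε * p))))) := by
        refine mul_le_mul_of_nonneg_left ((h4 N hN a).trans ?_) (by positivity)
        have := hlog N hN
        gcongr
    _ = Q * ((N : ℝ) ^ (p / 2 - 2) * (N : ℝ) ^ (1 : ℝ) * (N : ℝ) ^ (ε * p)) *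
          (s ^ (p - 4) * s ^ (4 : ℝ)) := by
        rw [Real.sqrt_mul (by norm_num), Real.mul_rpow hs0 (by positivity),
          Real.mul_rpow (by positivity) (by positivity), hNs, hAs, Real.rpow_one, hQ]
        ring
    _ = Q * (N : ℝ) ^ (((1 : ℝ) / 2 - 1 / p + ε) * p) * s ^ p := by
        rw [← Real.rpow_add hN0, ← Real.rpow_add hN0,
          ← Real.rpow_add_of_nonneg hs0 (by linarith) (by norm_num)]
        congr 2
        · congr 1
          field_simp
          ring
        · ring
    _ = _ := by
        rw [Real.mul_rpow (by positivity) hs0, Real.mul_rpow (by positivity) (by positivity),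
          ← Real.rpow_mul hQ0.le, ← Real.rpow_mul hN0.le, one_div_mul_cancel hp0.ne', Real.rpow_one]
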